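/- The set of (2,0)-admissible data equals exactly the following seventeen tuples (g'; N; (d_1, …, d_{N−1})), all with a_i = 0: (0; 2; (6)); (0; 3; (2,2)); (0; 4; (1,2,1)); (0; 5; (2,0,1,0)); (0; 5; (0,1,0,2)); (0; 5; (1,2,0,0)); (0; 5; (0,0,2,1)); (0; 6; (2,0,0,1,0)); (0; 6; (0,1,0,0,2)); (0; 6; (0,1,2,1,0)); (0; 8; (1,0,1,1,0,0,0)); (0; 8; (0,0,0,1,1,0,1)); (0; 10; (0,1,1,0,1,0,0,0,0)); (0; 10; (0,0,0,0,1,0,1,1,0)); (0; 10; (1,0,0,1,1,0,0,0,0)); (0; 10; (0,0,0,0,1,1,0,0,1)); and (1; 2; (2)). (This is the table of Section 2.2 of the paper, listing the twisted sectors τ, III, IV, X.4, X.6, X.2, X.8, V.1, V.2, VI, VIII.1, VIII.2, X.7, X.3, X.1, X.9 and II of M_2.) -/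

import Mathlib

/-- A `(g,n)`-admissible datum (Definition 2.2 of the paper): a tuple
`(g', N, d₁, …, d_{N−1}, a₁, …, a_{N−1})` of natural numbers with `N ≥ 2`,
where `d` and `a` are encoded as functions `ℕ → ℕ` vanishing outside `{1, …, N−1}`,
satisfying the Riemann–Hurwitz formula, the congruence `Σ i·dᵢ ≡ 0 (mod N)`,
`Σ aᵢ = n`, `aᵢ ≤ dᵢ`, and `aᵢ = 0` whenever `gcd(i, N) ≠ 1`. -/
structure AdmissibleDatum (g n : ℕ) where
  g' : ℕ
  N : ℕ
  hN : 2 ≤ N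
  d : ℕ → ℕ
  a : ℕ → ℕ
  hd : ∀ i : ℕ, i ∉ Finset.Ico 1 N → d i = 0
  ha : ∀ i : ℕ, i ∉ Finset.Ico 1 N → a i = 0
  hRH : (2 * (g : ℤ) - 2) = (N : ℤ) * (2 * (g' : ℤ) - 2) +
      ∑ i ∈ Finset.Ico 1 N,
        (d i : ℤ) * (Nat.gcd i N : ℤ) * (((N / Nat.gcd i N : ℕ) : ℤ) - 1)
  hmod : ((∑ i ∈ Finset.Ico 1 N, i * d i : ℕ) : ZMod N) = 0
  hsum : ∑ i ∈ Finset.Ico 1 N, a i = n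
  hle : ∀ i : ℕ, a i ≤ d i
  hcop : ∀ i : ℕ, Nat.gcd i N ≠ 1 → a i = 0

/-- The seventeen tuples `(g'; N; (d 1, ..., d (N-1)))` from the table of Section 2.2
of the paper. -/
def specList : List (ℕ × ℕ × List ℕ) :=
  [(0, 2, [6]), (0, 3, [2, 2]), (0, 4, [1, 2, 1]),
   (0, 5, [2, 0, 1, 0]), (0, 5, [0, 1, 0, 2]), (0, 5, [1, 2, 0, 0]), (0, 5, [0, 0, 2, 1]),
   (0, 6, [2, 0, 0, 1, 0]), (0, 6, [0, 1, 0, 0, 2]), (0, 6, [0, 1, 2, 1, 0]),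
   (0, 8, [1, 0, 1, 1, 0, 0, 0]), (0, 8, [0, 0, 0, 1, 1, 0, 1]),
   (0, 10, [0, 1, 1, 0, 1, 0, 0, 0, 0]), (0, 10, [0, 0, 0, 0, 1, 0, 1, 1, 0]),
   (0, 10, [1, 0, 0, 1, 1, 0, 0, 0, 0]), (0, 10, [0, 0, 0, 0, 1, 1, 0, 0, 1]),
   (1, 2, [2])]

/-- A `(2,0)`-admissible datum matches a tuple `(g'; N; (d 1, ..., d (N-1)))` if its
quotient genus is `g'`, its order is `N`, and its branching numbers `d (i+1)` are given by
the `i`-th entry of the list. -/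
def Matches (A : AdmissibleDatum 2 0) (s : ℕ × ℕ × List ℕ) : Prop :=
  A.g' = s.1 ∧ A.N = s.2.1 ∧ ∀ i : ℕ, i < s.2.1 - 1 → A.d (i + 1) = s.2.2.getD i 0

/-- The finite check that a list of branch residues gives one of the seventeen tuples. -/
def GoodList (g N : ℕ) (l : List ℕ) : Prop :=
  ∃ s ∈ specList, g = s.1 ∧ N = s.2.1 ∧ ∀ i : ℕ, i < s.2.1 - 1 → l.count (i + 1) = s.2.2.getD i 0

instance (g N : ℕ) (l : List ℕ) : Decidable (GoodList g N l) := by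
  unfold GoodList; infer_instance

theorem two_gcd_le {x N : ℕ} (h1 : 1 ≤ x) (h2 : x < N) : 2 * Nat.gcd x N ≤ N := by
  obtain ⟨k, hk⟩ := Nat.gcd_dvd_right x N
  have hle : Nat.gcd x N ≤ x := Nat.gcd_le_left _ h1
  rcases k with _ | _ | k
  · omega
  · omega
  · nlinarith

theorem three_gcd_le {x N : ℕ} (h1 : 1 ≤ x) (h2 : x < N) :
    2 * Nat.gcd x N = N ∨ 3 * Nat.gcd x N ≤ N := by
  obtain ⟨k, hk⟩ := Nat.gcd_dvd_right x N
  have hle : Nat.gcd x N ≤ x := Nat.gcd_le_left _ h1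
  rcases k with _ | _ | _ | k
  · omega
  · omega
  · omega
  · right; nlinarith

theorem pair_bound {x y z N : ℕ} (hN : 2 ≤ N)
    (hs : N ∣ x + y + z) (he : N = 2 + Nat.gcd x N + Nat.gcd y N + Nat.gcd z N) :
    Nat.gcd x N * Nat.gcd y N ≤ 2 * N := by
  set c := Nat.gcd (Nat.gcd x N) (Nat.gcd y N) with hc
  have hcx : c ∣ Nat.gcd x N := Nat.gcd_dvd_left _ _
  have hcy : c ∣ Nat.gcd y N := Nat.gcd_dvd_right _ _
  have hcN : c ∣ N := hcx.trans (Nat.gcd_dvd_right _ _)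
  have hz : c ∣ z := (Nat.dvd_add_right ((hcx.trans (Nat.gcd_dvd_left _ _)).add
    (hcy.trans (Nat.gcd_dvd_left _ _)))).1 (hcN.trans hs)
  have hcz : c ∣ Nat.gcd z N := Nat.dvd_gcd hz hcN
  have h2 : c ∣ 2 := by
    have : c ∣ (Nat.gcd x N + Nat.gcd y N + Nat.gcd z N) + 2 := by
      have e : (Nat.gcd x N + Nat.gcd y N + Nat.gcd z N) + 2 = N := by omega
      rw [e]; exact hcN
    exact (Nat.dvd_add_right ((hcx.add hcy).add hcz)).1 this
  have hc2 : c ≤ 2 := Nat.le_of_dvd (by norm_num) h2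
  have hl : Nat.lcm (Nat.gcd x N) (Nat.gcd y N) ≤ N :=
    Nat.le_of_dvd (by omega) (Nat.lcm_dvd (Nat.gcd_dvd_right _ _) (Nat.gcd_dvd_right _ _))
  calc _ = c * Nat.lcm (Nat.gcd x N) (Nat.gcd y N) := (Nat.gcd_mul_lcm _ _).symm
    _ ≤ 2 * N := Nat.mul_le_mul hc2 hl

theorem max_bound {a b c N : ℕ} (hc : 1 ≤ c) (he : N = 2 + a + b + c) (hac : a ≤ c) (hbc : b ≤ c)
    (h1 : a * c ≤ 2 * N) (h2 : b * c ≤ 2 * N) (h3 : 2 * c ≤ N) : N ≤ 44 := by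
  have ha : a ≤ 10 := by
    by_contra h
    have : 11 * c ≤ a * c := Nat.mul_le_mul_right _ (by omega)
    omega
  have hb : b ≤ 10 := by
    by_contra h
    have : 11 * c ≤ b * c := Nat.mul_le_mul_right _ (by omega)
    omega
  omega

theorem three_bound {x y z N : ℕ} (hN : 2 ≤ N) (hx : 1 ≤ x ∧ x < N) (hy : 1 ≤ y ∧ y < N)
    (hz : 1 ≤ z ∧ z < N)
    (hs : N ∣ x + y + z) (he : N = 2 + Nat.gcd x N + Nat.gcd y N + Nat.gcd z N) : N ≤ 44 := by
  have hxy := pair_bound hN hs he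
  have hxz := pair_bound (x := x) (y := z) (z := y) hN
    (by rw [show x + z + y = x + y + z by ring]; exact hs) (by omega)
  have hyz := pair_bound (x := y) (y := z) (z := x) hN
    (by rw [show y + z + x = x + y + z by ring]; exact hs) (by omega)
  have kx := two_gcd_le hx.1 hx.2
  have ky := two_gcd_le hy.1 hy.2
  have kz := two_gcd_le hz.1 hz.2
  have px : 1 ≤ Nat.gcd x N := Nat.gcd_pos_of_pos_left _ hx.1
  have py : 1 ≤ Nat.gcd y N := Nat.gcd_pos_of_pos_left _ hy.1
  have pz : 1 ≤ Nat.gcd z N := Nat.gcd_pos_of_pos_left _ hz.1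
  generalize Nat.gcd x N = a at *
  generalize Nat.gcd y N = b at *
  generalize Nat.gcd z N = c at *
  by_cases h1 : a ≤ c ∧ b ≤ c
  · exact max_bound pz he h1.1 h1.2 hxz hyz kz
  by_cases h2 : a ≤ b ∧ c ≤ b
  · exact max_bound (a := a) (b := c) py (by omega) h2.1 h2.2 hxy (by linarith [mul_comm b c]) ky
  · exact max_bound (a := b) (b := c) px (by omega) (by omega) (by omega)
      (by linarith [mul_comm a b]) (by linarith [mul_comm a c]) kx

/-- The last residue is determined by the sum of the others. -/
theorem last_eq {t z N : ℕ} (hz : z < N) (hs : N ∣ t + z) : z = (N - t % N) % N := by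
  have hN : 0 < N := by omega
  have ht := Nat.mod_lt t hN
  have h : N ∣ t % N + z := by
    rw [Nat.dvd_iff_mod_eq_zero] at *
    simpa [Nat.add_mod] using hs
  obtain ⟨k, hk⟩ := h
  rcases k with _ | _ | k
  · have : t % N = 0 := by omega
    have h0 : z = 0 := by omega
    simp [this, h0]
  · have e : N - t % N = z := by omega
    rw [e, Nat.mod_eq_of_lt hz]
  · nlinarith

set_option synthInstance.maxSize 4000 in
set_option synthInstance.maxHeartbeats 400000 in
theorem check_three : ∀ N < 45, ∀ x < N, ∀ y < N,
    N = 2 + Nat.gcd x N + Nat.gcd y N + Nat.gcd ((N - (x + y) % N) % N) N → 1 ≤ x → 1 ≤ y →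
    1 ≤ (N - (x + y) % N) % N → GoodList 0 N [x, y, (N - (x + y) % N) % N] := by
  decide +kernel

set_option synthInstance.maxSize 4000 in
set_option synthInstance.maxHeartbeats 400000 in
theorem check_four : ∀ N < 13, ∀ x < N, ∀ y < N, ∀ z < N,
    2 * N = 2 + Nat.gcd x N + Nat.gcd y N + Nat.gcd z N +
      Nat.gcd ((N - (x + y + z) % N) % N) N → 1 ≤ x → 1 ≤ y → 1 ≤ z →
    1 ≤ (N - (x + y + z) % N) % N → GoodList 0 N [x, y, z, (N - (x + y + z) % N) % N] := by
  decide +kernel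

set_option synthInstance.maxSize 4000 in
set_option synthInstance.maxHeartbeats 400000 in
theorem check_five : ∀ N < 5, ∀ x < N, ∀ y < N, ∀ z < N, ∀ u < N, ∀ v < N,
    3 * N = 2 + Nat.gcd x N + Nat.gcd y N + Nat.gcd z N + Nat.gcd u N + Nat.gcd v N →
    0 < x * y * z * u * v ∧ N ∣ x + y + z + u + v →
    GoodList 0 N [x, y, z, u, v] := by
  decide +kernel

theorem check_one_one : ∀ N < 5, ∀ x < N, 1 ≤ x → ¬ (N ∣ x) := by
  decide +kernel

theorem core {g N : ℕ} (hN : 2 ≤ N) (l : List ℕ) (hl : ∀ x ∈ l, 1 ≤ x ∧ x < N)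
    (hRH : (2 : ℤ) = N * (2 * (g : ℤ) - 2) + (l.map (fun i => (N : ℤ) - (Nat.gcd i N : ℤ))).sum)
    (hs : N ∣ l.sum) : GoodList g N l := by
  have hlow : ∀ l : List ℕ, (∀ x ∈ l, 1 ≤ x ∧ x < N) →
      (N : ℤ) * l.length ≤ 2 * (l.map (fun i => (N : ℤ) - (Nat.gcd i N : ℤ))).sum := by
    intro l
    induction l with
    | nil => intro _; simp
    | cons x t ih =>
      intro h
      have h1 := ih (fun y hy => h y (List.mem_cons_of_mem _ hy))
      have h2 := h x List.mem_cons_self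
      have h3 := two_gcd_le h2.1 h2.2
      simp only [List.map_cons, List.sum_cons, List.length_cons]
      push_cast
      zify at h3
      linarith
  have hb := hlow l hl
  have hN' : (2 : ℤ) ≤ N := by exact_mod_cast hN
  have hg : g ≤ 1 := by
    by_contra h
    have : (2 : ℤ) ≤ g := by exact_mod_cast (by omega : 2 ≤ g)
    have h0 : (0 : ℤ) ≤ N * (l.length : ℤ) := by positivity
    nlinarith
  interval_cases g
  · have hlen : (N : ℤ) * l.length ≤ 4 * N + 4 := by push_cast at hRH; linarith
    have hlen' : N * l.length ≤ 4 * N + 4 := by exact_mod_cast hlen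
    have h6 : l.length ≤ 6 := by
      by_contra h
      have : N * 7 ≤ N * l.length := Nat.mul_le_mul_left _ (by omega)
      omega
    match l, hl, hRH, hs, hlen', h6 with
    | [], _, hRH, _, _, _ => simp at hRH; omega
    | [x], hl, hRH, _, _, _ => simp at hRH; omega
    | [x, y], hl, hRH, _, _, _ =>
      simp at hl hRH
      have px : 1 ≤ Nat.gcd x N := Nat.gcd_pos_of_pos_left _ hl.1.1
      omega
    | [x, y, z], hl, hRH, hs, _, _ =>
      simp at hl hRH hs
      obtain ⟨hx, hy, hz⟩ := hl
      rw [← add_assoc] at hs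
      have he : N = 2 + Nat.gcd x N + Nat.gcd y N + Nat.gcd z N := by omega
      have hB := three_bound hN hx hy hz hs he
      have hz' := last_eq hz.2 hs
      have := check_three N (by omega) x hx.2 y hy.2
      rw [← hz'] at this
      exact this he hx.1 hy.1 hz.1
    | [x, y, z, w], hl, hRH, hs, _, _ =>
      simp at hl hRH hs
      obtain ⟨hx, hy, hz, hw⟩ := hl
      rw [← add_assoc, ← add_assoc] at hs
      have he : 2 * N = 2 + Nat.gcd x N + Nat.gcd y N + Nat.gcd z N + Nat.gcd w N := by omega
      have kx := three_gcd_le hx.1 hx.2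
      have ky := three_gcd_le hy.1 hy.2
      have kz := three_gcd_le hz.1 hz.2
      have kw := three_gcd_le hw.1 hw.2
      have hB : N ≤ 12 := by omega
      have hz' := last_eq hw.2 hs
      have := check_four N (by omega) x hx.2 y hy.2 z hz.2
      rw [← hz'] at this
      exact this he hx.1 hy.1 hz.1 hw.1
    | [x, y, z, u, v], hl, hRH, hs, hlen', _ =>
      simp at hl hRH hs hlen'
      obtain ⟨hx, hy, hz, hu, hv⟩ := hl
      refine check_five N (by omega) x hx.2 y hy.2 z hz.2 u hu.2 v hv.2 (by omega)
        ⟨Nat.mul_pos (Nat.mul_pos (Nat.mul_pos (Nat.mul_pos hx.1 hy.1) hz.1) hu.1) hv.1, ?_⟩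
      simpa [add_assoc] using hs
    | [x, y, z, u, v, w], hl, hRH, hs, hlen', _ =>
      simp at hl hlen'
      have hN2 : N = 2 := by omega
      subst hN2
      obtain ⟨hx, hy, hz, hu, hv, hw⟩ := hl
      have ex : x = 1 := by omega
      have ey : y = 1 := by omega
      have ez : z = 1 := by omega
      have eu : u = 1 := by omega
      have ev : v = 1 := by omega
      have ew : w = 1 := by omega
      subst ex ey ez eu ev ew
      decide
    | _ :: _ :: _ :: _ :: _ :: _ :: _ :: _, _, _, _, _, h6 =>
      simp only [List.length_cons] at h6; omega
  · have hlen : (N : ℤ) * l.length ≤ 4 := by push_cast at hRH; linarith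
    have hlen' : N * l.length ≤ 4 := by exact_mod_cast hlen
    have h6 : l.length ≤ 2 := by
      by_contra h
      have : N * 3 ≤ N * l.length := Nat.mul_le_mul_left _ (by omega)
      omega
    match l, hl, hRH, hs, hlen', h6 with
    | [], _, hRH, _, _, _ => simp at hRH
    | [x], hl, hRH, hs, hlen', _ =>
      simp at hl hs hlen'
      exact absurd hs (check_one_one N (by omega) x hl.2 hl.1)
    | [x, y], hl, hRH, hs, hlen', _ =>
      simp at hl hlen'
      have hN2 : N = 2 := by omega
      subst hN2
      have ex : x = 1 := by omega
      have ey : y = 1 := by omega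
      subst ex ey
      decide
    | _ :: _ :: _ :: _, _, _, _, _, h6 =>
      simp only [List.length_cons] at h6; omega

theorem check_spec : ∀ s ∈ specList, 2 ≤ s.2.1 ∧ s.2.2.length = s.2.1 - 1 ∧
    (2 : ℤ) = (s.2.1 : ℤ) * (2 * (s.1 : ℤ) - 2) + ∑ i ∈ Finset.Ico 1 s.2.1,
        (s.2.2.getD (i - 1) 0 : ℤ) * (Nat.gcd i s.2.1 : ℤ) *
          (((s.2.1 / Nat.gcd i s.2.1 : ℕ) : ℤ) - 1) ∧
    s.2.1 ∣ ∑ i ∈ Finset.Ico 1 s.2.1, i * s.2.2.getD (i - 1) 0 := by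
  decide +kernel

/-- The set of `(2,0)`-admissible data equals exactly the seventeen tuples of the table of
Section 2.2 of the paper: every `(2,0)`-admissible datum matches one of the seventeen
tuples, and every one of the seventeen tuples is matched by some `(2,0)`-admissible
datum. -/
theorem admissibleDatum_two_zero_classification :
    (∀ A : AdmissibleDatum 2 0, ∃ s ∈ specList, Matches A s) ∧
    (∀ s ∈ specList, ∃ A : AdmissibleDatum 2 0, Matches A s) := by
  refine ⟨fun A => ?_, fun s hs => ?_⟩
  · set M : Multiset ℕ := ∑ i ∈ Finset.Ico 1 A.N, A.d i • ({i} : Multiset ℕ) with hM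
    have hcount : ∀ j ∈ Finset.Ico 1 A.N, M.count j = A.d j := by
      intro j hj
      rw [hM, Multiset.count_sum']
      simp only [Multiset.count_nsmul, Multiset.count_singleton]
      simp [hj] at *
    have hmem : ∀ x ∈ M, 1 ≤ x ∧ x < A.N := by
      intro x hx
      rw [hM, Multiset.mem_sum] at hx
      obtain ⟨i, hi, hx⟩ := hx
      have := Multiset.mem_of_mem_nsmul hx
      rw [Multiset.mem_singleton] at this
      subst this
      exact Finset.mem_Ico.1 hi
    have hmap : (M.map (fun i => (A.N : ℤ) - (Nat.gcd i A.N : ℤ))).sum =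
        ∑ i ∈ Finset.Ico 1 A.N, (A.d i : ℤ) * ((A.N : ℤ) - (Nat.gcd i A.N : ℤ)) := by
      rw [hM, ← Multiset.coe_mapAddMonoidHom, map_sum, ← Multiset.coe_sumAddMonoidHom, map_sum]
      refine Finset.sum_congr rfl fun i _ => ?_
      rw [map_nsmul, map_nsmul]
      simp
    have hsum : M.sum = ∑ i ∈ Finset.Ico 1 A.N, i * A.d i := by
      rw [hM, ← Multiset.coe_sumAddMonoidHom, map_sum]
      refine Finset.sum_congr rfl fun i _ => ?_
      rw [map_nsmul]
      simp [mul_comm]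
    have hg : GoodList A.g' A.N M.toList := by
      refine core A.hN _ (fun x hx => hmem x (Multiset.mem_toList.1 hx)) ?_ ?_
      · have h := A.hRH
        rw [← Multiset.sum_coe, ← Multiset.map_coe, Multiset.coe_toList, hmap]
        have e2 : (2 * ((2 : ℕ) : ℤ) - 2) = 2 := by norm_num
        rw [e2] at h
        refine h.trans ?_
        congr 1
        refine Finset.sum_congr rfl fun i _ => ?_
        have e : (Nat.gcd i A.N : ℤ) * ((A.N / Nat.gcd i A.N : ℕ) : ℤ) = (A.N : ℤ) := by
          exact_mod_cast Nat.mul_div_cancel' (Nat.gcd_dvd_right i A.N)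
        linear_combination (A.d i : ℤ) * e
      · rw [Multiset.sum_toList, hsum]
        exact (ZMod.natCast_eq_zero_iff _ _).1 A.hmod
    obtain ⟨s, hs, h1, h2, h3⟩ := hg
    refine ⟨s, hs, h1, h2, fun i hi => ?_⟩
    rw [← h3 i hi, ← hcount (i + 1) (Finset.mem_Ico.2 ⟨by omega, by omega⟩),
      ← Multiset.coe_count, Multiset.coe_toList]
  · obtain ⟨h1, h2, h3, h4⟩ := check_spec s hs
    have key : ∀ i ∈ Finset.Ico 1 s.2.1, (if i = 0 then 0 else s.2.2.getD (i - 1) 0) =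
        s.2.2.getD (i - 1) 0 := by
      intro i hi
      rw [if_neg]
      have := (Finset.mem_Ico.1 hi).1
      omega
    refine ⟨{
      g' := s.1
      N := s.2.1
      hN := h1
      d := fun i => if i = 0 then 0 else s.2.2.getD (i - 1) 0
      a := fun _ => 0
      hd := ?_
      ha := fun _ _ => rfl
      hRH := ?_
      hmod := ?_
      hsum := by simp
      hle := fun _ => Nat.zero_le _
      hcop := fun _ _ => rfl }, rfl, rfl, fun i _ => by simp⟩
    · intro i hi
      rw [Finset.mem_Ico] at hi
      show (if i = 0 then 0 else s.2.2.getD (i - 1) 0) = 0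
      split_ifs with h0
      · rfl
      · exact List.getD_eq_default _ _ (by omega)
    · have e : (2 * ((2 : ℕ) : ℤ) - 2) = 2 := by norm_num
      rw [e]
      refine h3.trans ?_
      congr 1
      refine Finset.sum_congr rfl fun i hi => ?_
      rw [key i hi]
    · rw [ZMod.natCast_eq_zero_iff, Finset.sum_congr rfl fun i hi => by rw [key i hi]]
      exact h4
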